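/- For every real x ≥ 0, with h = ⌈n/2⌉, the quantity (1/2^h)·Σ_{a=0}^{h} Σ_{0 ≤ k ≤ x·√n} [q^k] g_{a,h−a}(q) converges, as n → ∞, to ∫_0^x (2/√π)·e^{−t²} dt; that is, the mixture Y_{h−J_h,J_h} (with J_h binomial(h,1/2) and Y given by the normalized coefficients of g), scaled by √n, converges in distribution to a half-normal random variable with density (2/√π)·e^{−x²} on [0,∞). -/

import Mathlib

/-- The polynomials `g_{m1,m2}(q)` defined by the recurrence
`g_{m1,m2}(q) = q^{δ(c,m1)} g_{m1-1,m2}(q) + g_{m1,m2-1}(q)` with `c = ⌊(m1+m2)/2⌋+1`,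
`g_{0,0} = 1` and `g` vanishing for negative indices. -/
noncomputable def gP : ℕ → ℕ → Polynomial ℝ
  | 0, 0 => 1
  | 0, m2 + 1 => gP 0 m2
  | m1 + 1, 0 =>
      Polynomial.X ^ (if (m1 + 1) / 2 + 1 = m1 + 1 then 1 else 0) * gP m1 0
  | m1 + 1, m2 + 1 =>
      Polynomial.X ^ (if (m1 + 1 + (m2 + 1)) / 2 + 1 = m1 + 1 then 1 else 0) * gP m1 (m2 + 1)
        + gP (m1 + 1) m2

/-- `P(t) = (1 - √(1-4t))/2`, the generating function of shifted Catalan numbers. -/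
noncomputable def Pgf (t : ℝ) : ℝ := (1 - Real.sqrt (1 - 4 * t)) / 2


open Filter

/-- The expectation of `f` after `h` steps of the Markov chain started at `s` which moves
along `u` or `v` with probability `1/2` each. -/
noncomputable def walkExp {σ : Type*} (u v : σ → σ) : ℕ → (σ → ℝ) → σ → ℝ
  | 0, f, s => f s
  | h + 1, f, s => (walkExp u v h f (u s) + walkExp u v h f (v s)) / 2

section walkExp

variable {σ τ : Type*} {u v : σ → σ} {u' v' : τ → τ}

lemma walkExp_mono {f g : σ → ℝ} (hfg : ∀ s, f s ≤ g s) (h : ℕ) (s : σ) :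
    walkExp u v h f s ≤ walkExp u v h g s := by
  induction h generalizing s with
  | zero => exact hfg s
  | succ h ih =>
    have h1 := ih (u s)
    have h2 := ih (v s)
    simp only [walkExp]
    linarith

lemma walkExp_add (f g : σ → ℝ) (h : ℕ) (s : σ) :
    walkExp u v h (fun s => f s + g s) s = walkExp u v h f s + walkExp u v h g s := by
  induction h generalizing s with
  | zero => rfl
  | succ h ih => simp only [walkExp, ih]; ring

lemma walkExp_const_mul (c : ℝ) (f : σ → ℝ) (h : ℕ) (s : σ) :
    walkExp u v h (fun s => c * f s) s = c * walkExp u v h f s := by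
  induction h generalizing s with
  | zero => rfl
  | succ h ih => simp only [walkExp, ih]; ring

lemma walkExp_const (c : ℝ) (h : ℕ) (s : σ) : walkExp u v h (fun _ => c) s = c := by
  induction h generalizing s with
  | zero => rfl
  | succ h ih => simp only [walkExp, ih]; ring

lemma walkExp_sub (f g : σ → ℝ) (h : ℕ) (s : σ) :
    walkExp u v h (fun s => f s - g s) s = walkExp u v h f s - walkExp u v h g s := by
  have := walkExp_add (u := u) (v := v) f (fun s => -1 * g s) h s
  rw [walkExp_const_mul] at this
  simpa [sub_eq_add_neg] using this

lemma walkExp_succ' (f : σ → ℝ) (h : ℕ) (s : σ) :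
    walkExp u v (h + 1) f s = walkExp u v h (fun s => (f (u s) + f (v s)) / 2) s := by
  induction h generalizing s with
  | zero => rfl
  | succ h ih => rw [walkExp, ih, ih]; rfl

lemma walkExp_comp (π : σ → τ) (hu : ∀ s, π (u s) = u' (π s)) (hv : ∀ s, π (v s) = v' (π s))
    (f : τ → ℝ) (h : ℕ) (s : σ) :
    walkExp u v h (fun s => f (π s)) s = walkExp u' v' h f (π s) := by
  induction h generalizing s with
  | zero => rfl
  | succ h ih => simp only [walkExp, ih, hu, hv]

lemma walkExp_le_of_superharmonic {f : σ → ℝ} (hf : ∀ s, (f (u s) + f (v s)) / 2 ≤ f s)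
    (h : ℕ) (s : σ) : walkExp u v h f s ≤ f s := by
  induction h generalizing s with
  | zero => exact le_rfl
  | succ h ih =>
    have h1 := ih (u s)
    have h2 := ih (v s)
    have h3 := hf s
    simp only [walkExp]
    linarith

end walkExp

/-- The expectation of `f` after `h` steps of the simple random walk on `ℤ`. -/
noncomputable abbrev simpleExp : ℕ → (ℤ → ℝ) → ℤ → ℝ := walkExp (· + 1) (· - 1)

lemma simpleExp_shift (f : ℤ → ℝ) (h : ℕ) (d : ℤ) :
    simpleExp h f d = simpleExp h (fun e => f (e + d)) 0 := by
  have := walkExp_comp (u := fun x : ℤ => x + 1) (v := fun x : ℤ => x - 1)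
    (u' := fun x : ℤ => x + 1) (v' := fun x : ℤ => x - 1) (fun e => e + d)
    (fun s => by ring) (fun s => by ring) f h 0
  simpa using this.symm

lemma simpleExp_sq (h : ℕ) (d : ℤ) : simpleExp h (fun e => (e : ℝ) ^ 2) d = d ^ 2 + h := by
  induction h generalizing d with
  | zero => simp [walkExp]
  | succ h ih =>
    simp only [simpleExp] at ih
    simp only [simpleExp, walkExp, ih]; push_cast; ring

/-- The probability that the simple random walk from `0` lies in `[-m, m)` after `h` steps. -/
noncomputable def centralProb (h : ℕ) (m : ℤ) : ℝ :=
  simpleExp h (fun d => if -m ≤ d ∧ d < m then 1 else 0) 0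

lemma centralProb_of_nonpos (h : ℕ) {m : ℤ} (hm : m ≤ 0) : centralProb h m = 0 := by
  have : (fun d : ℤ => if -m ≤ d ∧ d < m then (1 : ℝ) else 0) = fun _ => 0 := by
    funext d
    rw [if_neg]
    omega
  rw [centralProb, this, simpleExp, walkExp_const]

lemma centralProb_succ (h : ℕ) {m : ℤ} (hm : 1 ≤ m) :
    centralProb (h + 1) m = (centralProb h (m - 1) + centralProb h (m + 1)) / 2 := by
  have h1 := walkExp_add (u := fun x : ℤ => x + 1) (v := fun x : ℤ => x - 1)
    (fun d => if -m ≤ d + 1 ∧ d + 1 < m then 1 else 0)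
    (fun d => if -m ≤ d - 1 ∧ d - 1 < m then 1 else 0) h 0
  have h2 := walkExp_add (u := fun x : ℤ => x + 1) (v := fun x : ℤ => x - 1)
    (fun d => if -(m - 1) ≤ d ∧ d < m - 1 then 1 else 0)
    (fun d => if -(m + 1) ≤ d ∧ d < m + 1 then 1 else 0) h 0
  have h3 : ∀ d : ℤ, ((if -m ≤ d + 1 ∧ d + 1 < m then 1 else 0) +
      (if -m ≤ d - 1 ∧ d - 1 < m then 1 else 0) : ℝ) =
      (if -(m - 1) ≤ d ∧ d < m - 1 then 1 else 0) +
      (if -(m + 1) ≤ d ∧ d < m + 1 then 1 else 0) := by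
    intro d
    split_ifs <;> first | (exfalso; omega) | norm_num
  simp only [h3] at h1
  rw [h1] at h2
  simp only [centralProb, ← h2]
  simp only [simpleExp, walkExp]
  have e1 := simpleExp_shift (fun d => if -m ≤ d ∧ d < m then 1 else 0) h (0 + 1)
  have e2 := simpleExp_shift (fun d => if -m ≤ d ∧ d < m then 1 else 0) h (0 - 1)
  simp only [simpleExp] at e1 e2
  rw [e1, e2]
  simp [sub_eq_add_neg]

/-- Up-step of the walk together with the number of crossings of the edge `{0, 1}`. -/
def crossUp (s : ℤ × ℤ) : ℤ × ℤ := (s.1 + 1, s.2 + if s.1 = 0 then 1 else 0)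

/-- Down-step of the walk together with the number of crossings of the edge `{0, 1}`. -/
def crossDown (s : ℤ × ℤ) : ℤ × ℤ := (s.1 - 1, s.2 + if s.1 = 1 then 1 else 0)

lemma walkExp_cross_aux (h : ℕ) (m d k : ℤ) :
    walkExp crossUp crossDown h (fun s => if s.2 < m then 1 else 0) (d, k) =
      if k < m then centralProb h (m - k + if 1 ≤ d then d - 1 else -d) else 0 := by
  induction h generalizing d k with
  | zero =>
    simp only [walkExp, centralProb]
    split_ifs <;> first | rfl | (exfalso; omega)
  | succ h ih =>
    simp only [walkExp, crossUp, crossDown, ih]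
    by_cases hk : k < m
    · rw [if_pos hk, centralProb_succ h (by split_ifs <;> omega)]
      rcases lt_trichotomy d 0 with hd | hd | hd
      · rw [if_neg (by omega : ¬ d = 0), if_neg (by omega : ¬ d = 1), if_neg (by omega : ¬ 1 ≤ d),
          if_neg (by omega : ¬ 1 ≤ d + 1), if_neg (by omega : ¬ 1 ≤ d - 1), add_zero,
          if_pos hk, if_pos hk]
        congr 3 <;> ring
      · subst hd
        norm_num [hk]
        split_ifs with h1
        · ring_nf
        · rw [centralProb_of_nonpos h (by omega : m - k - 1 ≤ 0)]
      · rcases eq_or_ne d 1 with h1 | h1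
        · subst h1
          norm_num [hk]
          rw [add_comm]
          split_ifs with h1
          · ring_nf
          · rw [centralProb_of_nonpos h (by omega : m - k - 1 ≤ 0)]
        · rw [if_neg (by omega : ¬ d = 0), if_neg h1, if_pos (by omega : 1 ≤ d),
            if_pos (by omega : 1 ≤ d + 1), if_pos (by omega : 1 ≤ d - 1), add_zero,
            if_pos hk, if_pos hk, add_comm]
          congr 3 <;> ring
    · simp only [if_neg hk]
      rw [if_neg (by split_ifs <;> omega), if_neg (by split_ifs <;> omega)]
      simp

lemma walkExp_cross (h : ℕ) (m : ℤ) :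
    walkExp crossUp crossDown h (fun s => if s.2 < m then 1 else 0) (0, 0) = centralProb h m := by
  rw [walkExp_cross_aux]
  split_ifs with h1 h2
  · omega
  · simp
  · rw [centralProb_of_nonpos h (by omega)]

/-- Up-step of the walk together with the number of up-steps from `{0, 1}`. -/
def upstepUp (s : ℤ × ℤ) : ℤ × ℤ := (s.1 + 1, s.2 + if s.1 = 0 ∨ s.1 = 1 then 1 else 0)

/-- Down-step of the walk together with the number of up-steps from `{0, 1}`. -/
def upstepDown (s : ℤ × ℤ) : ℤ × ℤ := (s.1 - 1, s.2)

/-- Up-step of the walk with both counters: up-steps from `{0, 1}`, crossings of `{0, 1}`. -/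
def jointUp (s : ℤ × ℤ × ℤ) : ℤ × ℤ × ℤ :=
  (s.1 + 1, s.2.1 + if s.1 = 0 ∨ s.1 = 1 then 1 else 0, s.2.2 + if s.1 = 0 then 1 else 0)

/-- Down-step of the walk with both counters: up-steps from `{0, 1}`, crossings of `{0, 1}`. -/
def jointDown (s : ℤ × ℤ × ℤ) : ℤ × ℤ × ℤ :=
  (s.1 - 1, s.2.1, s.2.2 + if s.1 = 1 then 1 else 0)

lemma walkExp_joint_upstep (f : ℤ × ℤ → ℝ) (h : ℕ) (s : ℤ × ℤ × ℤ) :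
    walkExp jointUp jointDown h (fun s => f (s.1, s.2.1)) s =
      walkExp upstepUp upstepDown h f (s.1, s.2.1) :=
  walkExp_comp (fun s : ℤ × ℤ × ℤ => (s.1, s.2.1)) (fun _ => rfl) (fun _ => rfl) f h s

lemma walkExp_joint_cross (f : ℤ × ℤ → ℝ) (h : ℕ) (s : ℤ × ℤ × ℤ) :
    walkExp jointUp jointDown h (fun s => f (s.1, s.2.2)) s =
      walkExp crossUp crossDown h f (s.1, s.2.2) :=
  walkExp_comp (fun s : ℤ × ℤ × ℤ => (s.1, s.2.2)) (fun _ => rfl) (fun _ => rfl) f h s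

lemma walkExp_joint_simple (f : ℤ → ℝ) (h : ℕ) (s : ℤ × ℤ × ℤ) :
    walkExp jointUp jointDown h (fun s => f s.1) s = simpleExp h f s.1 :=
  walkExp_comp (fun s : ℤ × ℤ × ℤ => s.1) (fun _ => rfl) (fun _ => rfl) f h s

/-- The two counters differ by a martingale whose bracket is compensated by `|d - 1/2|`. -/
lemma superharmonic_joint (s : ℤ × ℤ × ℤ) :
    ((((jointUp s).2.1 - (jointUp s).2.2 : ℝ) ^ 2 - 2 * |((jointUp s).1 : ℝ) - 1 / 2|) +
      (((jointDown s).2.1 - (jointDown s).2.2 : ℝ) ^ 2 -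
        2 * |((jointDown s).1 : ℝ) - 1 / 2|)) / 2 ≤
      (s.2.1 - s.2.2 : ℝ) ^ 2 - 2 * |(s.1 : ℝ) - 1 / 2| := by
  obtain ⟨d, n, k⟩ := s
  simp only [jointUp, jointDown]
  rcases lt_trichotomy d 0 with hd | hd | hd
  · have hd' : (d : ℝ) ≤ -1 := by exact_mod_cast Int.le_sub_one_of_lt hd
    rw [if_neg (by omega), if_neg (by omega), if_neg (by omega)]
    push_cast
    rw [abs_of_nonpos (by linarith), abs_of_nonpos (by linarith), abs_of_nonpos (by linarith)]
    linarith
  · subst hd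
    norm_num [abs_of_nonneg, abs_of_nonpos]
    ring_nf
    norm_num
  · rcases eq_or_ne d 1 with h1 | h1
    · subst h1
      norm_num [abs_of_nonneg, abs_of_nonpos]
      nlinarith
    · have hd' : (2 : ℝ) ≤ d := by exact_mod_cast (by omega : 2 ≤ d)
      rw [if_neg (by omega), if_neg (by omega), if_neg (by omega)]
      push_cast
      rw [abs_of_nonneg (by linarith), abs_of_nonneg (by linarith), abs_of_nonneg (by linarith)]
      linarith

lemma walkExp_joint_sq_le (h : ℕ) :
    walkExp jointUp jointDown h (fun s => (s.2.1 - s.2.2 : ℝ) ^ 2) (0, 0, 0) ≤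
      2 * √h := by
  have h1 := walkExp_le_of_superharmonic (u := jointUp) (v := jointDown)
    (f := fun s => (s.2.1 - s.2.2 : ℝ) ^ 2 - 2 * |(s.1 : ℝ) - 1 / 2|)
    superharmonic_joint h (0, 0, 0)
  rw [walkExp_sub, walkExp_const_mul,
    walkExp_joint_simple (fun d : ℤ => |(d : ℝ) - 1 / 2|)] at h1
  norm_num [abs_of_nonneg, abs_of_nonpos] at h1
  rcases Nat.eq_zero_or_pos h with rfl | hh
  · simp [walkExp]
  have hs : 0 < √(h : ℝ) := Real.sqrt_pos.2 (by exact_mod_cast hh)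
  have h2 : simpleExp h (fun d : ℤ => |(d : ℝ) - 1 / 2|) 0 ≤
      simpleExp h (fun d : ℤ => (1 / (2 * √h)) * (d : ℝ) ^ 2 + (√h / 2 + 1 / 2)) 0 := by
    refine walkExp_mono (fun d => ?_) h 0
    have h3 : |(d : ℝ) - 1 / 2| ≤ |(d : ℝ)| + 1 / 2 := by
      refine (abs_sub _ _).trans ?_
      norm_num [abs_of_nonneg]
    have h4 : |(d : ℝ)| ≤ (1 / (2 * √h)) * (d : ℝ) ^ 2 + √h / 2 := by
      rw [← sq_abs (d : ℝ)]
      have : (1 / (2 * √h)) * |(d : ℝ)| ^ 2 + √h / 2 - |(d : ℝ)| =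
          (|(d : ℝ)| - √h) ^ 2 / (2 * √h) := by
        field_simp; ring
      have : 0 ≤ (|(d : ℝ)| - √h) ^ 2 / (2 * √h) := by positivity
      linarith
    linarith
  rw [simpleExp, walkExp_add, walkExp_const_mul, walkExp_const] at h2
  have h5 := simpleExp_sq h 0
  simp only [simpleExp] at h5 h1
  rw [h5] at h2
  have h6 : 1 / (2 * √(h : ℝ)) * (((0 : ℤ) : ℝ) ^ 2 + h) = √h / 2 := by
    field_simp
    simp
  rw [h6] at h2
  linarith

/-- Pairing of a polynomial with a function on exponents. -/
noncomputable def polyPair (f : ℕ → ℝ) (p : Polynomial ℝ) : ℝ := p.sum fun k c => c * f k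

lemma polyPair_add (f : ℕ → ℝ) (p q : Polynomial ℝ) :
    polyPair f (p + q) = polyPair f p + polyPair f q :=
  Polynomial.sum_add_index p q _ (fun _ => zero_mul _) (fun _ _ _ => add_mul _ _ _)

lemma polyPair_monomial (f : ℕ → ℝ) (k : ℕ) (c : ℝ) :
    polyPair f (Polynomial.monomial k c) = c * f k :=
  Polynomial.sum_monomial_index c _ (zero_mul _)

lemma polyPair_X_pow_mul (f : ℕ → ℝ) (e : ℕ) (p : Polynomial ℝ) :
    polyPair f (Polynomial.X ^ e * p) = polyPair (fun k => f (k + e)) p := by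
  induction p using Polynomial.induction_on' with
  | add p q hp hq => rw [mul_add, polyPair_add, polyPair_add, hp, hq]
  | monomial k c =>
    rw [Polynomial.X_pow_mul_monomial, polyPair_monomial, polyPair_monomial]

lemma tsum_ite_coeff (P : ℕ → Prop) [DecidablePred P] (p : Polynomial ℝ) :
    ∑' k, (if P k then p.coeff k else 0) = polyPair (fun k => if P k then 1 else 0) p := by
  rw [polyPair, Polynomial.sum_def, tsum_eq_sum (s := p.support)]
  · simp
  · intro k hk
    simp [Polynomial.notMem_support_iff.1 hk]

/-- Summing `gP` over an antidiagonal is running the walk that counts up-steps from `{0, 1}`. -/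
lemma sum_polyPair_gP (h : ℕ) (f : ℤ × ℤ → ℝ) :
    ∑ a ∈ Finset.range (h + 1), polyPair (fun k => f (2 * a - h, k)) (gP a (h - a)) =
      2 ^ h * walkExp upstepUp upstepDown h f (0, 0) := by
  induction h generalizing f with
  | zero =>
    have hg : gP 0 0 = 1 := by rw [gP]
    simp only [zero_add, Finset.range_one, Finset.sum_singleton, walkExp]
    have := polyPair_monomial (fun k => f (2 * (0 : ℕ) - (0 : ℕ), k)) 0 1
    simpa [hg] using this
  | succ h ih =>
    have step : ∀ a ∈ Finset.range (h + 1 + 1),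
        polyPair (fun k => f (2 * a - (h + 1 : ℕ), k)) (gP a (h + 1 - a)) =
        (if a = 0 then 0 else
          polyPair (fun k => f (upstepUp (2 * (a - 1 : ℕ) - h, k))) (gP (a - 1) (h - (a - 1)))) +
        (if a = h + 1 then 0 else
          polyPair (fun k => f (upstepDown (2 * a - h, k))) (gP a (h - a))) := by
      intro a ha
      have ha' : a ≤ h + 1 := by simpa [Nat.lt_succ_iff] using ha
      have down : ∀ k : ℕ, f (upstepDown (2 * (a : ℤ) - h, k)) =
          f (2 * a - (h + 1 : ℕ), k) := by
        intro k
        simp only [upstepDown]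
        congr 2
        push_cast; ring
      have up : ∀ b : ℕ, a = b + 1 → ∀ k : ℕ, f (upstepUp (2 * (b : ℤ) - h, k)) =
          f (2 * a - (h + 1 : ℕ), (k + (if (h + 1) / 2 + 1 = a then 1 else 0) : ℕ)) := by
        intro b hb k
        simp only [upstepUp]
        congr 2
        · push_cast [hb]; ring
        · push_cast
          congr 1
          split_ifs <;> first | rfl | (exfalso; omega)
      simp only [down]
      rcases a with _ | b
      · simp [gP]
      · rw [if_neg (by omega), Nat.add_sub_cancel]
        simp only [up b rfl]
        rw [← polyPair_X_pow_mul (fun k : ℕ => f (2 * ((b + 1 : ℕ) : ℤ) - ((h + 1 : ℕ) : ℤ), k))]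
        obtain ⟨c, rfl⟩ := Nat.exists_eq_add_of_le (by omega : b ≤ h)
        rcases c with _ | c
        · simp [gP]
        · have e1 : b + (c + 1) + 1 - (b + 1) = c + 1 := by omega
          have e2 : b + (c + 1) - b = c + 1 := by omega
          have e3 : b + (c + 1) - (b + 1) = c := by omega
          have e4 : b + (c + 1) + 1 = b + 1 + (c + 1) := by omega
          rw [e1, e2, e3, if_neg (by omega : ¬ b + 1 = b + (c + 1) + 1), gP, polyPair_add, e4]
    rw [Finset.sum_congr rfl step, Finset.sum_add_distrib, Finset.sum_range_succ',
      Finset.sum_range_succ (fun a => if a = h + 1 then (0 : ℝ) else _)]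
    have e1 : ∀ a ∈ Finset.range (h + 1),
        (if a = h + 1 then (0 : ℝ) else
          polyPair (fun k => f (upstepDown (2 * a - h, k))) (gP a (h - a))) =
        polyPair (fun k => f (upstepDown (2 * a - h, k))) (gP a (h - a)) := by
      intro a ha
      rw [if_neg (Finset.mem_range.1 ha).ne]
    rw [Finset.sum_congr rfl e1]
    simp only [Nat.add_sub_cancel, if_true, add_zero, if_neg (Nat.succ_ne_zero _)]
    rw [ih (fun s => f (upstepUp s)), ih (fun s => f (upstepDown s)), ← mul_add, ← walkExp_add,
      walkExp_succ', pow_succ, mul_assoc, ← walkExp_const_mul 2]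
    congr 2
    funext s
    ring

section CentralLimit

open MeasureTheory ProbabilityTheory Topology
open scoped ENNReal NNReal

/-- The uniform distribution on `{1, -1}`. -/
noncomputable def signMeasure : Measure ℝ :=
  (1 / 2 : ℝ≥0∞) • Measure.dirac 1 + (1 / 2 : ℝ≥0∞) • Measure.dirac (-1)

instance : IsProbabilityMeasure signMeasure :=
  ⟨by simp [signMeasure, ENNReal.inv_two_add_inv_two]⟩

/-- The law at time `h` of the simple random walk on `ℤ` started at `0`, seen in `ℝ`. -/
noncomputable def walkMeasure : ℕ → Measure ℝ
  | 0 => Measure.dirac 0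
  | h + 1 => signMeasure ∗ walkMeasure h

instance (h : ℕ) : IsProbabilityMeasure (walkMeasure h) := by
  induction h with
  | zero => rw [walkMeasure]; infer_instance
  | succ h ih => rw [walkMeasure]; infer_instance

lemma walkMeasure_succ_real (h : ℕ) {S : Set ℝ} (hS : MeasurableSet S) :
    (walkMeasure (h + 1)).real S =
      ((walkMeasure h).real {y | 1 + y ∈ S} + (walkMeasure h).real {y | -1 + y ∈ S}) / 2 := by
  have e : walkMeasure (h + 1) = (1 / 2 : ℝ≥0∞) • (walkMeasure h).map (fun y => 1 + y) +
      (1 / 2 : ℝ≥0∞) • (walkMeasure h).map (fun y => -1 + y) := by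
    rw [walkMeasure, signMeasure, Measure.add_conv, Measure.conv_smul_left,
      Measure.conv_smul_left, Measure.dirac_conv, Measure.dirac_conv]
  rw [e, measureReal_def, Measure.add_apply, Measure.smul_apply, Measure.smul_apply,
    Measure.map_apply (by fun_prop) hS, Measure.map_apply (by fun_prop) hS, smul_eq_mul,
    smul_eq_mul, ENNReal.toReal_add (by finiteness) (by finiteness), ENNReal.toReal_mul,
    ENNReal.toReal_mul]
  simp only [measureReal_def, Set.preimage]
  norm_num
  ring

lemma simpleExp_eq_walkMeasure_real {S : Set ℝ} (hS : MeasurableSet S) [DecidablePred (· ∈ S)]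
    (h : ℕ) (d : ℤ) :
    simpleExp h (fun e => if (e : ℝ) ∈ S then 1 else 0) d =
      (walkMeasure h).real {y | (d : ℝ) + y ∈ S} := by
  have hm : ∀ c : ℝ, MeasurableSet {y | c + y ∈ S} := fun c =>
    (measurable_const_add c) hS
  induction h generalizing d with
  | zero =>
    rw [walkMeasure, measureReal_def, Measure.dirac_apply' _ (hm _)]
    by_cases hd : (d : ℝ) ∈ S <;> simp [walkExp, hd]
  | succ h ih =>
    simp only [simpleExp] at ih
    rw [walkMeasure_succ_real h (hm _)]
    simp only [simpleExp, walkExp, ih]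
    simp [← add_assoc, sub_eq_add_neg]

lemma charFun_walkMeasure (h : ℕ) (t : ℝ) :
    charFun (walkMeasure h) t = charFun signMeasure t ^ h := by
  induction h with
  | zero => simp [walkMeasure, charFun_dirac]
  | succ h ih => rw [walkMeasure, charFun_conv, ih, pow_succ']

lemma integral_signMeasure (f : ℝ → ℝ) : ∫ y, f y ∂signMeasure = (f 1 + f (-1)) / 2 := by
  rw [signMeasure, integral_add_measure]
  · simp [integral_smul_measure]
    ring
  · exact (integrable_dirac (by simp)).smul_measure (by simp)
  · exact (integrable_dirac (by simp)).smul_measure (by simp)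

lemma tendsto_charFun_walkMeasure (t : ℝ) :
    Tendsto (fun h : ℕ => charFun ((walkMeasure h).map ((√(2 * h : ℝ))⁻¹ * ·)) t) atTop
      (𝓝 (charFun (gaussianReal 0 (1 / 2)) t)) := by
  have h1 := tendsto_charFun_inv_sqrt_mul_pow (P := signMeasure) (X := id) aemeasurable_id
    (by rw [integral_signMeasure]; simp) (by
      rw [integral_signMeasure]; simp) ((√2)⁻¹ * t)
  simp only [Measure.map_id] at h1
  rw [charFun_gaussianReal]
  convert h1 using 2 with h
  · rw [charFun_map_mul, charFun_walkMeasure]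
    congr 2
    rw [Real.sqrt_mul (by norm_num), mul_inv]
    ring
  · congr 1
    push_cast
    rw [mul_pow, inv_pow, ← Complex.ofReal_pow (√2), Real.sq_sqrt (by norm_num)]
    push_cast
    ring

/-- The distribution function of the half-normal law. -/
noncomputable def halfNormalCdf (c : ℝ) : ℝ :=
  ∫ t in (0 : ℝ)..max c 0, 2 / √Real.pi * Real.exp (-t ^ 2)

lemma continuous_halfNormalCdf : Continuous halfNormalCdf := by
  have : Continuous fun c : ℝ => ∫ t in (0 : ℝ)..c, 2 / √Real.pi * Real.exp (-t ^ 2) :=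
    intervalIntegral.continuous_primitive
      (fun a b => Continuous.intervalIntegrable (by fun_prop) a b) 0
  exact this.comp (continuous_id.max continuous_const)

lemma gaussianReal_Icc (c : ℝ) :
    (gaussianReal 0 (1 / 2)).real (Set.Icc (-c) c) = halfNormalCdf c := by
  rcases lt_or_ge c 0 with hc | hc
  · rw [Set.Icc_eq_empty (by linarith), halfNormalCdf, max_eq_right hc.le]
    simp
  have hpdf : ∀ t : ℝ, gaussianPDFReal 0 (1 / 2) t = 1 / √Real.pi * Real.exp (-t ^ 2) := by
    intro t
    rw [gaussianPDFReal]
    have h2 : 2 * Real.pi * ((1 / 2 : ℝ≥0) : ℝ) = Real.pi := by push_cast; ring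
    have h3 : -(t - 0) ^ 2 / (2 * ((1 / 2 : ℝ≥0) : ℝ)) = -t ^ 2 := by push_cast; ring
    rw [h2, h3, one_div]
  have hint : ∀ a b : ℝ, IntervalIntegrable
      (fun t => 1 / √Real.pi * Real.exp (-t ^ 2)) volume a b :=
    fun a b => Continuous.intervalIntegrable (by fun_prop) a b
  rw [measureReal_def, gaussianReal_apply_eq_integral _ (by norm_num), ENNReal.toReal_ofReal
    (integral_nonneg fun t => gaussianPDFReal_nonneg _ _ _), integral_Icc_eq_integral_Ioc,
    ← intervalIntegral.integral_of_le (by linarith), halfNormalCdf, max_eq_left hc]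
  simp only [hpdf]
  rw [← intervalIntegral.integral_add_adjacent_intervals (hint (-c) 0) (hint 0 c)]
  have e := intervalIntegral.integral_comp_neg (a := 0) (b := c)
    (fun t => 1 / √Real.pi * Real.exp (-t ^ 2))
  simp only [neg_zero, neg_sq] at e
  rw [← e, ← two_mul, ← intervalIntegral.integral_const_mul]
  congr 1
  funext t
  ring

/-- The central limit theorem for the simple random walk on symmetric intervals. -/
lemma tendsto_simpleExp_abs_le (c : ℝ) :
    Tendsto (fun h : ℕ => simpleExp h (fun d => if |(d : ℝ)| ≤ c * √(2 * h) then 1 else 0) 0)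
      atTop (𝓝 (halfNormalCdf c)) := by
  let μs : ℕ → ProbabilityMeasure ℝ := fun h =>
    ⟨(walkMeasure h).map ((√(2 * h : ℝ))⁻¹ * ·), Measure.isProbabilityMeasure_map (by fun_prop)⟩
  let μ : ProbabilityMeasure ℝ := ⟨gaussianReal 0 (1 / 2), inferInstance⟩
  have hlim : Tendsto μs atTop (𝓝 μ) :=
    ProbabilityMeasure.tendsto_iff_tendsto_charFun.2 tendsto_charFun_walkMeasure
  have : NullSingletonClass (μ : Measure ℝ) :=
    nullSingletonClass_gaussianReal (by norm_num : (1 / 2 : ℝ≥0) ≠ 0)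
  have hfr : (μ : Measure ℝ) (frontier (Set.Icc (-c) c)) = 0 := by
    rcases le_or_gt (-c) c with hc | hc
    · rw [frontier_Icc hc]
      exact (Set.toFinite _).measure_zero _
    · simp [Set.Icc_eq_empty hc.not_ge]
  have key := (ENNReal.tendsto_toReal (measure_ne_top _ _)).comp
    (ProbabilityMeasure.tendsto_measure_of_null_frontier_of_tendsto' hlim hfr)
  rw [← gaussianReal_Icc]
  refine key.congr' ?_
  filter_upwards [eventually_gt_atTop 0] with h hh
  have hs : 0 < √(2 * h : ℝ) := Real.sqrt_pos.2 (by positivity)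
  have e := simpleExp_eq_walkMeasure_real (S := {y : ℝ | |y| ≤ c * √(2 * h)})
    (measurableSet_le (by fun_prop) (by fun_prop)) h 0
  simp only [Set.mem_ofPred_eq, Int.cast_zero, zero_add] at e
  rw [e]
  simp only [Function.comp, μs, ProbabilityMeasure.coe_mk, measureReal_def]
  rw [Measure.map_apply (by fun_prop) measurableSet_Icc]
  congr 2
  ext y
  rw [Set.mem_preimage, Set.mem_Icc, ← abs_le, abs_mul, abs_of_pos (inv_pos.2 hs), Set.mem_ofPred_eq,
    inv_mul_le_iff₀ hs, mul_comm]

end CentralLimit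

lemma centralProb_le (h : ℕ) {m : ℤ} {y : ℝ} (hm : (m : ℝ) ≤ y) :
    centralProb h m ≤ simpleExp h (fun d => if |(d : ℝ)| ≤ y then 1 else 0) 0 := by
  refine walkExp_mono (fun d => ?_) h 0
  split_ifs with h1 h2
  · exact le_rfl
  · exfalso
    have e1 : -(m : ℝ) ≤ d := by exact_mod_cast h1.1
    have e2 : (d : ℝ) ≤ m := by exact_mod_cast h1.2.le
    exact h2 (abs_le.2 ⟨by linarith, by linarith⟩)
  · exact zero_le_one
  · exact le_rfl

lemma le_centralProb (h : ℕ) {m : ℤ} {y : ℝ} (hm : y < m) :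
    simpleExp h (fun d => if |(d : ℝ)| ≤ y then 1 else 0) 0 ≤ centralProb h m := by
  refine walkExp_mono (fun d => ?_) h 0
  split_ifs with h1 h2 h2
  · exact le_rfl
  · exfalso
    have e := abs_le.1 h1
    refine h2 ⟨?_, ?_⟩
    · have : -(m : ℝ) ≤ d := by linarith
      exact_mod_cast this
    · have : (d : ℝ) < m := by linarith
      exact_mod_cast this
  · exact zero_le_one
  · exact le_rfl

lemma walkExp_joint_cross_le (h : ℕ) (y : ℝ) :
    walkExp jointUp jointDown h (fun s => if (s.2.2 : ℝ) ≤ y then 1 else 0) (0, 0, 0) =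
      centralProb h (⌊y⌋ + 1) := by
  rw [← walkExp_cross, ← walkExp_joint_cross (fun s => if s.2 < ⌊y⌋ + 1 then 1 else 0) h (0, 0, 0)]
  simp only [Int.lt_add_one_iff, Int.le_floor]

/-- If `a ≤ y` then `b ≤ y + r` or `|a - b| > r`. -/
lemma indicator_le_add_sq {a b y r : ℝ} (hr : 0 < r) :
    (if a ≤ y then 1 else 0 : ℝ) ≤ (if b ≤ y + r then 1 else 0) + 1 / r ^ 2 * (a - b) ^ 2 := by
  have h0 : 0 ≤ 1 / r ^ 2 * (a - b) ^ 2 := by positivity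
  split_ifs with h1 h2
  · linarith
  · rw [zero_add, one_div, inv_mul_eq_div, le_div_iff₀ (by positivity)]
    nlinarith
  · linarith
  · linarith

lemma walkExp_upstep_le (h : ℕ) {y r : ℝ} (hr : 0 < r) :
    walkExp jointUp jointDown h (fun s => if (s.2.1 : ℝ) ≤ y then 1 else 0) (0, 0, 0) ≤
      centralProb h (⌊y + r⌋ + 1) + 1 / r ^ 2 * (2 * √h) := by
  have h1 := walkExp_mono (u := jointUp) (v := jointDown)
    (fun s : ℤ × ℤ × ℤ => indicator_le_add_sq (a := s.2.1) (b := s.2.2) (y := y) hr) h (0, 0, 0)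
  rw [walkExp_add, walkExp_const_mul, walkExp_joint_cross_le] at h1
  exact h1.trans (by gcongr; exact walkExp_joint_sq_le h)

lemma le_walkExp_upstep (h : ℕ) {y r : ℝ} (hr : 0 < r) :
    centralProb h (⌊y - r⌋ + 1) - 1 / r ^ 2 * (2 * √h) ≤
      walkExp jointUp jointDown h (fun s => if (s.2.1 : ℝ) ≤ y then 1 else 0) (0, 0, 0) := by
  have h1 := walkExp_mono (u := jointUp) (v := jointDown)
    (f := fun s => if (s.2.2 : ℝ) ≤ y - r then 1 else 0)
    (g := fun s => (if (s.2.1 : ℝ) ≤ y then 1 else 0) + 1 / r ^ 2 * (s.2.1 - s.2.2 : ℝ) ^ 2)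
    (fun s => by
      have := indicator_le_add_sq (a := s.2.2) (b := s.2.1) (y := y - r) hr
      rwa [sub_add_cancel, sub_sq_comm] at this) h (0, 0, 0)
  rw [walkExp_add, walkExp_const_mul, walkExp_joint_cross_le] at h1
  rw [sub_le_iff_le_add]
  exact h1.trans (by gcongr; exact walkExp_joint_sq_le h)

lemma scaled_sum_gP_eq (h : ℕ) (y : ℝ) :
    (1 / 2 ^ h : ℝ) * ∑ a ∈ Finset.range (h + 1),
        ∑' k : ℕ, (if (k : ℝ) ≤ y then (gP a (h - a)).coeff k else 0) =
      walkExp jointUp jointDown h (fun s => if (s.2.1 : ℝ) ≤ y then 1 else 0) (0, 0, 0) := by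
  rw [walkExp_joint_upstep (fun s => if (s.2 : ℝ) ≤ y then 1 else 0)]
  have e := sum_polyPair_gP h (fun s => if (s.2 : ℝ) ≤ y then 1 else 0)
  simp only [Int.cast_natCast] at e
  simp only [tsum_ite_coeff]
  rw [e]
  field_simp

lemma sqrt_le_sqrt_two_mul_half (n : ℕ) : √(n : ℝ) ≤ √(2 * ((n + 1) / 2 : ℕ) : ℝ) :=
  Real.sqrt_le_sqrt (by exact_mod_cast (by omega : n ≤ 2 * ((n + 1) / 2)))

lemma sqrt_two_mul_half_le (n : ℕ) : √(2 * ((n + 1) / 2 : ℕ) : ℝ) ≤ √(n : ℝ) + 1 := by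
  rw [Real.sqrt_le_left (by positivity)]
  have h1 : (2 * ((n + 1) / 2 : ℕ) : ℝ) ≤ n + 1 := by
    exact_mod_cast (by omega : 2 * ((n + 1) / 2) ≤ n + 1)
  nlinarith [Real.sq_sqrt (Nat.cast_nonneg (α := ℝ) n), Real.sqrt_nonneg (n : ℝ)]

lemma error_le {ε : ℝ} (n : ℕ) (hn : 0 < n) :
    1 / (ε * √(n : ℝ)) ^ 2 * (2 * √(((n + 1) / 2 : ℕ) : ℝ)) ≤ 2 / ε ^ 2 * (√(n : ℝ))⁻¹ := by
  have h1 : √(((n + 1) / 2 : ℕ) : ℝ) ≤ √(n : ℝ) :=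
    Real.sqrt_le_sqrt (by exact_mod_cast (by omega : (n + 1) / 2 ≤ n))
  have hs : 0 < √(n : ℝ) := Real.sqrt_pos.2 (by exact_mod_cast hn)
  calc 1 / (ε * √(n : ℝ)) ^ 2 * (2 * √(((n + 1) / 2 : ℕ) : ℝ))
      ≤ 1 / (ε * √(n : ℝ)) ^ 2 * (2 * √(n : ℝ)) := by gcongr
    _ = 2 / ε ^ 2 * (√(n : ℝ))⁻¹ := by
      rw [mul_pow]
      field_simp

theorem stmt10 (x : ℝ) (hx : 0 ≤ x) :
    Tendsto (fun n : ℕ =>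
        (1 / 2 ^ ((n + 1) / 2) : ℝ) *
          ∑ a ∈ Finset.range ((n + 1) / 2 + 1),
            ∑' k : ℕ,
              if (k : ℝ) ≤ x * Real.sqrt n then (gP a ((n + 1) / 2 - a)).coeff k else 0)
      atTop (nhds (∫ t in (0 : ℝ)..x, 2 / Real.sqrt Real.pi * Real.exp (-t ^ 2))) := by
  have hF : ∫ t in (0 : ℝ)..x, 2 / √Real.pi * Real.exp (-t ^ 2) = halfNormalCdf x := by
    rw [halfNormalCdf, max_eq_left hx]
  rw [hF]
  simp only [scaled_sum_gP_eq]
  have hhalf : Tendsto (fun n : ℕ => (n + 1) / 2) atTop atTop :=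
    tendsto_atTop_atTop.2 fun b => ⟨2 * b, fun n hn => by omega⟩
  have hsqrt : Tendsto (fun n : ℕ => √(n : ℝ)) atTop atTop :=
    Real.tendsto_sqrt_atTop.comp tendsto_natCast_atTop_atTop
  have herr : ∀ ε : ℝ, Tendsto (fun n : ℕ => 2 / ε ^ 2 * (√(n : ℝ))⁻¹) atTop (nhds 0) := by
    intro ε
    simpa using (tendsto_inv_atTop_zero.comp hsqrt).const_mul (2 / ε ^ 2)
  refine tendsto_order.2 ⟨fun a ha => ?_, fun a ha => ?_⟩
  · have hc : Continuous fun ε : ℝ => halfNormalCdf (x - 2 * ε) :=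
      continuous_halfNormalCdf.comp (by fun_prop)
    have h0 : ∀ᶠ ε in nhdsWithin (0 : ℝ) (Set.Ioi 0), a < halfNormalCdf (x - 2 * ε) :=
      (hc.continuousWithinAt (s := Set.Ioi 0) (x := 0)).eventually (lt_mem_nhds (by simpa using ha))
    obtain ⟨ε, hε, hε0⟩ := (h0.and self_mem_nhdsWithin).exists
    have hε0 : 0 < ε := hε0
    have hlim := ((tendsto_simpleExp_abs_le (x - 2 * ε)).comp hhalf).sub (herr ε)
    rw [sub_zero] at hlim
    filter_upwards [hlim.eventually (lt_mem_nhds hε), eventually_gt_atTop 0,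
      hsqrt.eventually_ge_atTop (x / ε)] with n h1 hn h2
    have hs : 0 < √(n : ℝ) := Real.sqrt_pos.2 (by exact_mod_cast hn)
    refine h1.trans_le ((sub_le_sub ?_ (error_le n hn)).trans
      (le_walkExp_upstep _ (mul_pos hε0 hs)))
    refine le_centralProb _ (lt_of_le_of_lt ?_ (by push_cast; exact Int.lt_floor_add_one _))
    rw [div_le_iff₀ hε0] at h2
    have h3 := sqrt_le_sqrt_two_mul_half n
    have h4 := sqrt_two_mul_half_le n
    rcases le_or_gt 0 (x - 2 * ε) with h5 | h5
    · have := mul_le_mul_of_nonneg_left h4 h5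
      nlinarith
    · have := mul_le_mul_of_nonpos_left h3 h5.le
      nlinarith
  · have hc : Continuous fun ε : ℝ => halfNormalCdf (x + 2 * ε) :=
      continuous_halfNormalCdf.comp (by fun_prop)
    have h0 : ∀ᶠ ε in nhdsWithin (0 : ℝ) (Set.Ioi 0), halfNormalCdf (x + 2 * ε) < a :=
      (hc.continuousWithinAt (s := Set.Ioi 0) (x := 0)).eventually (gt_mem_nhds (by simpa using ha))
    obtain ⟨ε, hε, hε0⟩ := (h0.and self_mem_nhdsWithin).exists
    have hε0 : 0 < ε := hε0
    have hlim := ((tendsto_simpleExp_abs_le (x + 2 * ε)).comp hhalf).add (herr ε)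
    rw [add_zero] at hlim
    filter_upwards [hlim.eventually (gt_mem_nhds hε), eventually_gt_atTop 0,
      hsqrt.eventually_ge_atTop (1 / ε)] with n h1 hn h2
    have hs : 0 < √(n : ℝ) := Real.sqrt_pos.2 (by exact_mod_cast hn)
    refine lt_of_le_of_lt ((walkExp_upstep_le _ (mul_pos hε0 hs)).trans
      (add_le_add ?_ (error_le n hn))) h1
    refine centralProb_le _ ?_
    rw [div_le_iff₀ hε0] at h2
    have h3 := mul_le_mul_of_nonneg_left (sqrt_le_sqrt_two_mul_half n)
      (by linarith : 0 ≤ x + 2 * ε)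
    have h4 := Int.floor_le (x * √(n : ℝ) + ε * √(n : ℝ))
    push_cast
    nlinarith
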